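/- Let μ be an n-dimensional AD-regular measure on ℝ^d, let B be a ball intersecting supp(μ), and fix an affine n-plane L that minimizes α₂(B), with Π_L the orthogonal projection onto L. Then W₂(φ_B μ, Π_L#(φ_B μ)) ≤ W₂(φ_B μ, c_{B,L}·φ_B·ℋⁿ⌊L). Moreover, β₂(B) ≤ α₂(B). -/

import Mathlib

open MeasureTheory Metric Set ENNReal
open scoped NNReal

noncomputable section

/-- The `p`-th Wasserstein distance between two measures, as a value in `ℝ≥0∞`. -/
def Wp {E : Type*} [EMetricSpace E] [MeasurableSpace E] (p : ℝ) (μ ν : Measure E) : ℝ≥0∞ :=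
  ⨅ π ∈ {π : Measure (E × E) | π.map Prod.fst = μ ∧ π.map Prod.snd = ν},
    (∫⁻ z, edist z.1 z.2 ^ p ∂π) ^ (1 / p)

/-- The (closed) support of a measure: points all of whose neighbourhoods have
positive measure. -/
def msupp {E : Type*} [MeasurableSpace E] [PseudoMetricSpace E] (μ : Measure E) : Set E :=
  {x | ∀ ε : ℝ, 0 < ε → 0 < μ (ball x ε)}

/-- `μ` is an `n`-dimensional Ahlfors-David regular measure with constant `c₀`:
`c₀⁻¹ rⁿ ≤ μ(B(x,r)) ≤ c₀ rⁿ` for `x ∈ supp μ` and `0 < r ≤ diam(supp μ)`. -/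
def ADRegular {d : ℕ} (n : ℕ) (c₀ : ℝ) (μ : Measure (EuclideanSpace ℝ (Fin d))) : Prop :=
  ∀ x ∈ msupp μ, ∀ r : ℝ, 0 < r → ENNReal.ofReal r ≤ EMetric.diam (msupp μ) →
    ENNReal.ofReal (c₀⁻¹ * r ^ n) ≤ μ (closedBall x r) ∧
      μ (closedBall x r) ≤ ENNReal.ofReal (c₀ * r ^ n)

/-- `μ` is uniformly `n`-rectifiable: `μ` has big pieces of Lipschitz images of `ℝⁿ`, i.e.
there are `θ, M > 0` so that for each `x ∈ supp μ` and `0 < r ≤ diam (supp μ)` there is an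
`M`-Lipschitz map `g : ℝⁿ → ℝ^d` with `μ(B(x,r) ∩ g(Bₙ(0,r))) ≥ θ rⁿ`. -/
def UnifRectifiable {d : ℕ} (n : ℕ) (μ : Measure (EuclideanSpace ℝ (Fin d))) : Prop :=
  ∃ θ M : ℝ, 0 < θ ∧ 0 < M ∧
    ∀ x ∈ msupp μ, ∀ r : ℝ, 0 < r → ENNReal.ofReal r ≤ EMetric.diam (msupp μ) →
      ∃ g : EuclideanSpace ℝ (Fin n) → EuclideanSpace ℝ (Fin d),
        LipschitzWith (Real.toNNReal M) g ∧
        ENNReal.ofReal (θ * r ^ n) ≤ μ (closedBall x r ∩ g '' (closedBall 0 r))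

/-- `φ` is an admissible radial bump function with constant `c₂`:
`φ : ℝ^d → [0,1]` is radial, Lipschitz, `χ_{B(0,2)} ≤ φ ≤ χ_{B(0,3)}`,
`c₂⁻¹ dist(x,∂B(0,3))² ≤ φ(x) ≤ c₂ dist(x,∂B(0,3))²` and
`|∇φ(x)| ≤ c₂ dist(x,∂B(0,3))` on `B(0,3)`. -/
def IsBump {d : ℕ} (c₂ : ℝ) (φ : EuclideanSpace ℝ (Fin d) → ℝ) : Prop :=
  (∃ K : ℝ≥0, LipschitzWith K φ) ∧
  (∀ x y : EuclideanSpace ℝ (Fin d), ‖x‖ = ‖y‖ → φ x = φ y) ∧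
  (∀ x, φ x ∈ Icc (0:ℝ) 1) ∧
  (∀ x : EuclideanSpace ℝ (Fin d), ‖x‖ ≤ 2 → φ x = 1) ∧
  (∀ x : EuclideanSpace ℝ (Fin d), 3 ≤ ‖x‖ → φ x = 0) ∧
  (∀ x : EuclideanSpace ℝ (Fin d), ‖x‖ < 3 →
    c₂⁻¹ * (3 - ‖x‖) ^ 2 ≤ φ x ∧ φ x ≤ c₂ * (3 - ‖x‖) ^ 2) ∧
  (∀ x : EuclideanSpace ℝ (Fin d), ‖x‖ < 3 → DifferentiableAt ℝ φ x →
    ‖fderiv ℝ φ x‖ ≤ c₂ * (3 - ‖x‖))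

/-- The rescaled bump `φ_B` adapted to the ball `B = B(x,r)`: `φ_B(y) = φ((y-x)/r)`. -/
def phiB {d : ℕ} (φ : EuclideanSpace ℝ (Fin d) → ℝ) (x : EuclideanSpace ℝ (Fin d)) (r : ℝ)
    (y : EuclideanSpace ℝ (Fin d)) : ℝ :=
  φ (r⁻¹ • (y - x))

/-- The normalizing constant `c_{B,L} = (∫φ_B dμ)/(∫φ_B dℋⁿ⌊L)`. -/
def cBL {d : ℕ} (n : ℕ) (φ : EuclideanSpace ℝ (Fin d) → ℝ)
    (μ : Measure (EuclideanSpace ℝ (Fin d))) (x : EuclideanSpace ℝ (Fin d)) (r : ℝ)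
    (L : AffineSubspace ℝ (EuclideanSpace ℝ (Fin d))) : ℝ :=
  (∫ y, phiB φ x r y ∂μ) /
    (∫ y, phiB φ x r y ∂((μH[(n:ℝ)]).restrict (L : Set (EuclideanSpace ℝ (Fin d)))))

/-- The flat measure `c_{B,L} φ_B ℋⁿ⌊L` against which `φ_B μ` is compared. -/
def flatB {d : ℕ} (n : ℕ) (φ : EuclideanSpace ℝ (Fin d) → ℝ)
    (μ : Measure (EuclideanSpace ℝ (Fin d))) (x : EuclideanSpace ℝ (Fin d)) (r : ℝ)
    (L : AffineSubspace ℝ (EuclideanSpace ℝ (Fin d))) :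
    Measure (EuclideanSpace ℝ (Fin d)) :=
  ENNReal.ofReal (cBL n φ μ x r L) •
    ((μH[(n:ℝ)]).restrict (L : Set (EuclideanSpace ℝ (Fin d)))).withDensity
      (fun y => ENNReal.ofReal (phiB φ x r y))

/-- The coefficient `α_p(B(x,r))` of the measure `μ` (with respect to the bump `φ`):
`α_p(B) = r^{-1-n/p} inf_L W_p(φ_B μ, c_{B,L} φ_B ℋⁿ⌊L)`, the infimum over all affine
`n`-planes `L` intersecting `B`. -/
def alphaP {d : ℕ} (n : ℕ) (p : ℝ) (φ : EuclideanSpace ℝ (Fin d) → ℝ)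
    (μ : Measure (EuclideanSpace ℝ (Fin d))) (x : EuclideanSpace ℝ (Fin d)) (r : ℝ) :
    ℝ≥0∞ :=
  ENNReal.ofReal (r ^ (-(1:ℝ) - n / p)) *
    ⨅ L ∈ {L : AffineSubspace ℝ (EuclideanSpace ℝ (Fin d)) |
        Module.finrank ℝ L.direction = n ∧
          ((L : Set (EuclideanSpace ℝ (Fin d))) ∩ closedBall x r).Nonempty},
      Wp p (μ.withDensity fun y => ENNReal.ofReal (phiB φ x r y)) (flatB n φ μ x r L)

/-- The coefficient `β_p(B(x,r))` of the measure `μ` for `p = 2`: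
`β₂(B)² = inf_L r^{-n} ∫_{2B} (dist(y,L)/r)² dμ(y)`, over all affine `n`-planes `L`. -/
def beta2 {d : ℕ} (n : ℕ) (μ : Measure (EuclideanSpace ℝ (Fin d)))
    (x : EuclideanSpace ℝ (Fin d)) (r : ℝ) : ℝ≥0∞ :=
  ⨅ L ∈ {L : AffineSubspace ℝ (EuclideanSpace ℝ (Fin d)) |
      Module.finrank ℝ L.direction = n},
    ((∫⁻ y in closedBall x (2 * r),
        ENNReal.ofReal ((infDist y (L : Set (EuclideanSpace ℝ (Fin d))) / r) ^ 2) ∂μ) /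
      ENNReal.ofReal (r ^ n)) ^ (1/2 : ℝ)

/-- `dist_B(σ,ν)`: the supremum of `|∫f dσ − ∫f dν|` over `1`-Lipschitz functions `f`
supported in `B`. -/
def distB {d : ℕ} (B : Set (EuclideanSpace ℝ (Fin d)))
    (σ ν : Measure (EuclideanSpace ℝ (Fin d))) : ℝ≥0∞ :=
  ⨆ f ∈ {f : EuclideanSpace ℝ (Fin d) → ℝ | LipschitzWith 1 f ∧ ∀ x ∉ B, f x = 0},
    ENNReal.ofReal |(∫ x, f x ∂σ) - (∫ x, f x ∂ν)|

/-- The coefficient `α(B(x,r))` of `[Tolsa, PLMS]`: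
`α(B) = r^{-n-1} inf_{a ≥ 0, L} dist_{3B}(μ, a ℋⁿ⌊L)`. -/
def alphaCoef {d : ℕ} (n : ℕ) (μ : Measure (EuclideanSpace ℝ (Fin d)))
    (x : EuclideanSpace ℝ (Fin d)) (r : ℝ) : ℝ≥0∞ :=
  ENNReal.ofReal (r ^ (-(n:ℝ) - 1)) *
    ⨅ (a : ℝ≥0) (L : {L : AffineSubspace ℝ (EuclideanSpace ℝ (Fin d)) //
        Module.finrank ℝ L.direction = n}),
      distB (closedBall x (3 * r)) μ
        ((a : ℝ≥0∞) • (μH[(n:ℝ)]).restrict ((L.1 : Set (EuclideanSpace ℝ (Fin d)))))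

/-- If `T` has displacement bounded by that of any point of `S`, then the transport cost of `T`
bounds `W_p(μ, ν)` from below for every `ν` concentrated on `S`. -/
lemma lintegral_edist_rpow_le_Wp {E : Type*} [EMetricSpace E] [MeasurableSpace E]
    [OpensMeasurableSpace E] [SecondCountableTopology E] {p : ℝ} (hp : 0 < p)
    {μ ν : Measure E} {S : Set E} (hν : ∀ᵐ y ∂ν, y ∈ S) {T : E → E} (hT : Measurable T)
    (hTS : ∀ y, ∀ w ∈ S, edist y (T y) ≤ edist y w) :
    (∫⁻ y, edist y (T y) ^ p ∂μ) ^ (1 / p) ≤ Wp p μ ν := by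
  refine le_iInf₂ fun π hπ => ?_
  obtain ⟨rfl, rfl⟩ := hπ
  have hcost : Measurable fun y => edist y (T y) ^ p :=
    (measurable_id.edist hT).pow_const p
  rw [lintegral_map hcost measurable_fst]
  refine ENNReal.rpow_le_rpow ?_ (by positivity)
  refine lintegral_mono_ae ?_
  filter_upwards [ae_of_ae_map measurable_snd.aemeasurable hν] with z hz
  exact ENNReal.rpow_le_rpow (hTS _ _ hz) hp.le

/-- The graph coupling bounds `W_p(μ, T#μ)` by the transport cost of `T`. -/
lemma Wp_map_le {E : Type*} [EMetricSpace E] [MeasurableSpace E]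
    [OpensMeasurableSpace E] [SecondCountableTopology E] (p : ℝ)
    (μ : Measure E) {T : E → E} (hT : Measurable T) :
    Wp p μ (μ.map T) ≤ (∫⁻ y, edist y (T y) ^ p ∂μ) ^ (1 / p) := by
  have hg : Measurable fun y => (y, T y) := measurable_id.prodMk hT
  refine (iInf₂_le (μ.map fun y => (y, T y)) ⟨?_, ?_⟩).trans_eq ?_
  · rw [lintegral_map ((measurable_fst.edist measurable_snd).pow_const p) hg]
  · rw [Measure.map_map measurable_fst hg]
    exact Measure.map_id
  · rw [Measure.map_map measurable_snd hg]
    rfl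

lemma ae_mem_flatB {d : ℕ} (n : ℕ) (φ : EuclideanSpace ℝ (Fin d) → ℝ)
    (μ : Measure (EuclideanSpace ℝ (Fin d))) (x : EuclideanSpace ℝ (Fin d)) (r : ℝ)
    (L : AffineSubspace ℝ (EuclideanSpace ℝ (Fin d))) :
    ∀ᵐ y ∂(flatB n φ μ x r L), y ∈ (L : Set (EuclideanSpace ℝ (Fin d))) := by
  have hac : flatB n φ μ x r L ≪
      (μH[(n:ℝ)]).restrict (L : Set (EuclideanSpace ℝ (Fin d))) :=
    (Measure.smul_absolutelyContinuous).trans (withDensity_absolutelyContinuous _ _)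
  exact hac.ae_le (ae_restrict_mem L.closed_of_finiteDimensional.measurableSet)

lemma IsBump.phiB_eq_one {d : ℕ} {c₂ : ℝ} {φ : EuclideanSpace ℝ (Fin d) → ℝ}
    (hφ : IsBump c₂ φ) {x y : EuclideanSpace ℝ (Fin d)} {r : ℝ} (hr : 0 < r)
    (hy : y ∈ closedBall x (2 * r)) : phiB φ x r y = 1 := by
  refine hφ.2.2.2.1 _ ?_
  rw [norm_smul, norm_inv, Real.norm_of_nonneg hr.le, inv_mul_le_iff₀ hr, mul_comm r]
  rwa [mem_closedBall, dist_eq_norm] at hy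

lemma IsBump.measurable_phiB {d : ℕ} {c₂ : ℝ} {φ : EuclideanSpace ℝ (Fin d) → ℝ}
    (hφ : IsBump c₂ φ) (x : EuclideanSpace ℝ (Fin d)) (r : ℝ) : Measurable (phiB φ x r) := by
  obtain ⟨K, hK⟩ := hφ.1
  exact hK.continuous.measurable.comp ((measurable_id.sub_const x).const_smul r⁻¹)

/-- `β₂(B)` is bounded by the normalized transport cost of any map into an `n`-plane `L`. -/
lemma beta2_le_transport {d n : ℕ} {c₂ : ℝ} {φ : EuclideanSpace ℝ (Fin d) → ℝ}
    (hφ : IsBump c₂ φ) (μ : Measure (EuclideanSpace ℝ (Fin d)))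
    (x : EuclideanSpace ℝ (Fin d)) {r : ℝ} (hr : 0 < r)
    {L : AffineSubspace ℝ (EuclideanSpace ℝ (Fin d))}
    (hL : Module.finrank ℝ L.direction = n)
    {T : EuclideanSpace ℝ (Fin d) → EuclideanSpace ℝ (Fin d)} (hT : Measurable T)
    (hTL : ∀ y, T y ∈ (L : Set (EuclideanSpace ℝ (Fin d)))) :
    beta2 n μ x r ≤ ENNReal.ofReal (r ^ (-(1:ℝ) - (n:ℝ) / 2)) *
      (∫⁻ y, edist y (T y) ^ (2:ℝ)
        ∂(μ.withDensity fun y => ENNReal.ofReal (phiB φ x r y))) ^ (1 / 2 : ℝ) := by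
  have hcost : Measurable fun y => edist y (T y) ^ (2:ℝ) :=
    (measurable_id.edist hT).pow_const _
  refine (iInf₂_le L hL).trans ?_
  have hint : ∫⁻ y in closedBall x (2 * r),
        ENNReal.ofReal ((infDist y (L : Set (EuclideanSpace ℝ (Fin d))) / r) ^ 2) ∂μ ≤
      ENNReal.ofReal (r ^ (-(2:ℝ))) * ∫⁻ y, edist y (T y) ^ (2:ℝ)
        ∂(μ.withDensity fun y => ENNReal.ofReal (phiB φ x r y)) := by
    rw [lintegral_withDensity_eq_lintegral_mul _ (hφ.measurable_phiB x r).ennreal_ofReal hcost,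
      ← lintegral_const_mul _ ((hφ.measurable_phiB x r).ennreal_ofReal.mul hcost)]
    refine (setLIntegral_mono' measurableSet_closedBall fun y hy => ?_).trans
      (setLIntegral_le_lintegral (closedBall x (2 * r)) _)
    rw [Pi.mul_apply, hφ.phiB_eq_one hr hy, ENNReal.ofReal_one, one_mul, edist_dist,
      ENNReal.ofReal_rpow_of_nonneg dist_nonneg zero_le_two,
      ← ENNReal.ofReal_mul (by positivity), Real.rpow_neg hr.le, Real.rpow_two, Real.rpow_two,
      inv_mul_eq_div, ← div_pow]
    have hdist := infDist_le_dist_of_mem (x := y) (hTL y)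
    have := infDist_nonneg (x := y) (s := (L : Set (EuclideanSpace ℝ (Fin d))))
    gcongr
  have hscale : ENNReal.ofReal (r ^ (-(1:ℝ) - (n:ℝ) / 2)) =
      (ENNReal.ofReal (r ^ (-(2:ℝ))) / ENNReal.ofReal (r ^ n)) ^ (1 / 2 : ℝ) := by
    rw [← ENNReal.ofReal_div_of_pos (by positivity),
      ENNReal.ofReal_rpow_of_nonneg (by positivity) (by norm_num), ← Real.rpow_natCast,
      ← Real.rpow_sub hr, ← Real.rpow_mul hr.le]
    ring_nf
  rw [hscale, ← ENNReal.mul_rpow_of_nonneg _ _ (by norm_num)]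
  refine ENNReal.rpow_le_rpow ?_ (by norm_num)
  rw [← ENNReal.mul_div_right_comm]
  gcongr

/-- Lemma 5.2.
If `L` is an `n`-plane minimizing `α₂(B)` and `Π_L` the orthogonal projection onto `L`,
then `W₂(φ_B μ, Π_L#(φ_B μ)) ≤ W₂(φ_B μ, c_{B,L} φ_B ℋⁿ⌊L)`; moreover `β₂(B) ≤ α₂(B)`. -/
theorem statement13 (n d : ℕ) (hnd : n ≤ d) (c₀ c₂ : ℝ) (hc₀ : 0 < c₀) (hc₂ : 0 < c₂)
    (μ : Measure (EuclideanSpace ℝ (Fin d))) (hμ : ADRegular n c₀ μ)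
    (φ : EuclideanSpace ℝ (Fin d) → ℝ) (hφ : IsBump c₂ φ)
    (x : EuclideanSpace ℝ (Fin d)) (r : ℝ) (hr : 0 < r)
    (hB : (closedBall x r ∩ msupp μ).Nonempty)
    (L : AffineSubspace ℝ (EuclideanSpace ℝ (Fin d)))
    (hL : Module.finrank ℝ L.direction = n)
    (hLB : ((L : Set (EuclideanSpace ℝ (Fin d))) ∩ closedBall x r).Nonempty)
    (hmin : ENNReal.ofReal (r ^ (-(1:ℝ) - (n:ℝ) / 2)) *
        Wp 2 (μ.withDensity fun y => ENNReal.ofReal (phiB φ x r y)) (flatB n φ μ x r L) =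
      alphaP n 2 φ μ x r)
    (PL : EuclideanSpace ℝ (Fin d) → EuclideanSpace ℝ (Fin d)) (hPLm : Measurable PL)
    (hPLmem : ∀ y, PL y ∈ (L : Set (EuclideanSpace ℝ (Fin d))))
    (hPLnear : ∀ y, ∀ w ∈ (L : Set (EuclideanSpace ℝ (Fin d))), dist y (PL y) ≤ dist y w) :
    Wp 2 (μ.withDensity fun y => ENNReal.ofReal (phiB φ x r y))
        (Measure.map PL (μ.withDensity fun y => ENNReal.ofReal (phiB φ x r y))) ≤
      Wp 2 (μ.withDensity fun y => ENNReal.ofReal (phiB φ x r y)) (flatB n φ μ x r L) ∧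
    beta2 n μ x r ≤ alphaP n 2 φ μ x r := by
  have hcost := lintegral_edist_rpow_le_Wp two_pos
    (μ := μ.withDensity fun y => ENNReal.ofReal (phiB φ x r y)) (ae_mem_flatB n φ μ x r L) hPLm
    fun y w hw => by
      simpa only [edist_dist] using ENNReal.ofReal_le_ofReal (hPLnear y w hw)
  refine ⟨(Wp_map_le 2 _ hPLm).trans hcost, ?_⟩
  rw [← hmin]
  exact (beta2_le_transport hφ μ x hr hL hPLm hPLmem).trans (mul_le_mul_right hcost _)
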